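/- Incorrect-prediction probability of the near-optimal abstaining strategy against nature's minimax play: (1/(2n))·∑_{i=1}^n (1 - p^alg_i)·(1 - g*_i z*_i) = (1/(2n))·( (1-θ) + ∑_{i>v} |a_i|/|a_v| ), and this quantity is at most (1/2)·(1 - (v-1)/n). -/

import Mathlib

open Finset

/-- The minimax optimal predictor strategy. -/
noncomputable def gstar (a : ℕ → ℝ) (v : ℕ) : ℕ → ℝ :=
  fun i => if i ≤ v then Real.sign (a i) else a i / |a v|

/-- Nature's minimax optimal strategy. -/
noncomputable def zstar (n : ℕ) (a : ℕ → ℝ) (lam : ℝ) (v : ℕ) : ℕ → ℝ :=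
  fun i =>
    if i < v then Real.sign (a i)
    else if i = v then ((n : ℝ) * lam - ∑ j ∈ Icc 1 (v - 1), |a j|) / a v
    else 0

/-- The near-optimal abstain probabilities. -/
noncomputable def palg (a : ℕ → ℝ) (v : ℕ) : ℕ → ℝ :=
  fun i => if i ≤ v then 0 else 1 - |a i| / |a v|

theorem sign_mul_div_self (x c : ℝ) : Real.sign x * (c / x) = c / |x| := by
  rcases lt_trichotomy x 0 with hx | rfl | hx
  · rw [Real.sign_of_neg hx, abs_of_neg hx, div_neg, neg_one_mul]
  · simp
  · rw [Real.sign_of_pos hx, abs_of_pos hx, one_mul]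

theorem sign_mul_sign_self {x : ℝ} (hx : x ≠ 0) : Real.sign x * Real.sign x = 1 := by
  rcases Real.sign_apply_eq_of_ne_zero x hx with h | h <;> simp [h]

theorem sum_Icc_one_eq_add_add {f : ℕ → ℝ} {v n : ℕ} (hv1 : 1 ≤ v) (hvn : v ≤ n) :
    ∑ i ∈ Icc 1 n, f i = ∑ i ∈ Icc 1 (v - 1), f i + f v + ∑ i ∈ Icc (v + 1) n, f i := by
  obtain ⟨w, rfl⟩ := Nat.exists_eq_add_of_le' hv1
  rw [Nat.add_sub_cancel, ← sum_Icc_succ_top (by omega)]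
  induction n, hvn using Nat.le_induction with
  | base => simp
  | succ m hm ih =>
    rw [sum_Icc_succ_top (by omega), ih, add_assoc,
      ← sum_Icc_succ_top (by omega : w + 1 + 1 ≤ m + 1)]

/-- incorrect-prediction probability of the near-optimal abstaining
strategy against nature's minimax play. -/
theorem incorrect_prediction_probability
    (n : ℕ) (hn : 1 ≤ n) (a : ℕ → ℝ)
    (hord : ∀ i j : ℕ, 1 ≤ i → i ≤ j → j ≤ n → |a j| ≤ |a i|)
    (lam : ℝ) (hlam_pos : 0 < lam)
    (hlam_le : lam ≤ (1 / (n : ℝ)) * ∑ i ∈ Icc 1 n, |a i|)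
    (v : ℕ) (hv1 : 1 ≤ v) (hvn : v ≤ n)
    (hv_ge : lam ≤ (1 / (n : ℝ)) * ∑ j ∈ Icc 1 v, |a j|)
    (hv_min : ∀ i : ℕ, 1 ≤ i → i < v → (1 / (n : ℝ)) * ∑ j ∈ Icc 1 i, |a j| < lam)
    (θ : ℝ)
    (hθ : θ = ((n : ℝ) * lam - ∑ i ∈ Icc 1 (v - 1), |a i|) / |a v|) :
    (1 / (2 * (n : ℝ))) * ∑ i ∈ Icc 1 n,
        (1 - palg a v i) * (1 - gstar a v i * zstar n a lam v i) =
      (1 / (2 * (n : ℝ))) * ((1 - θ) + ∑ i ∈ Icc (v + 1) n, |a i| / |a v|) ∧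
    (1 / (2 * (n : ℝ))) * ((1 - θ) + ∑ i ∈ Icc (v + 1) n, |a i| / |a v|) ≤
      (1 / 2) * (1 - ((v : ℝ) - 1) / n) := by
  have hn0 : (0 : ℝ) < n := by exact_mod_cast hn
  have hprefix : ∑ j ∈ Icc 1 (v - 1), |a j| < n * lam := by
    rcases Nat.eq_or_lt_of_le hv1 with rfl | hv
    · simpa using mul_pos hn0 hlam_pos
    · have h := hv_min (v - 1) (by omega) (by omega)
      rwa [one_div_mul_eq_div, div_lt_iff₀' hn0] at h
  have hav : 0 < |a v| := by
    rw [one_div_mul_eq_div, le_div_iff₀' hn0, sum_Icc_one_eq_add_add hv1 le_rfl] at hv_ge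
    simp only [Icc_eq_empty_of_lt (Nat.lt_succ_self v), sum_empty] at hv_ge
    linarith
  have hθ_pos : 0 < θ := hθ ▸ div_pos (sub_pos.2 hprefix) hav
  refine ⟨?_, ?_⟩
  · congr 1
    rw [sum_Icc_one_eq_add_add hv1 hvn]
    have hlow : ∑ i ∈ Icc 1 (v - 1),
        (1 - palg a v i) * (1 - gstar a v i * zstar n a lam v i) = 0 := by
      refine sum_eq_zero fun i hi => ?_
      rw [mem_Icc] at hi
      have hiv : i < v := by omega
      have hai : a i ≠ 0 := abs_pos.1 (hav.trans_le (hord i v hi.1 hiv.le hvn))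
      simp [gstar, zstar, hiv, hiv.le, sign_mul_sign_self hai]
    have hmid : (1 - palg a v v) * (1 - gstar a v v * zstar n a lam v v) = 1 - θ := by
      simp [palg, gstar, zstar, sign_mul_div_self, hθ]
    rw [hlow, hmid, zero_add]
    congr 1
    refine sum_congr rfl fun i hi => ?_
    rw [mem_Icc] at hi
    have hiv : ¬ i ≤ v := by omega
    have hlt : ¬ i < v := by omega
    have hne : i ≠ v := by omega
    simp [palg, zstar, hiv, hlt, hne]
  · have htail : ∑ i ∈ Icc (v + 1) n, |a i| / |a v| ≤ (n : ℝ) - v := by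
      calc ∑ i ∈ Icc (v + 1) n, |a i| / |a v| ≤ ∑ _i ∈ Icc (v + 1) n, (1 : ℝ) := by
            refine sum_le_sum fun i hi => ?_
            rw [mem_Icc] at hi
            exact (div_le_one hav).2 (hord v i hv1 (by omega) hi.2)
        _ = (n : ℝ) - v := by simp [Nat.cast_sub hvn]
    calc (1 / (2 * (n : ℝ))) * ((1 - θ) + ∑ i ∈ Icc (v + 1) n, |a i| / |a v|)
        ≤ (1 / (2 * (n : ℝ))) * (n - (v - 1)) := by gcongr; linarith
      _ = (1 / 2) * (1 - ((v : ℝ) - 1) / n) := by field_simp
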